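/- Let G be a concurrent stochastic game with a finite state set S, a sink target state ⊤, countable Max action sets, and with B(s) finite for every s ∈ S. Then Max has a single memoryless strategy σ that is optimal for Reach(⊤) from every state from which Max has any optimal strategy: for every s ∈ S such that some Max strategy is optimal from s, and every Min strategy π, P_{s,σ,π}(Reach(⊤)) ≥ val(Reach(⊤), s). -/

import Mathlib

open scoped ENNReal Classical

/-- One step of a play: a state together with the actions chosen by Max and Min there. -/
structure Step (S A B : Type) where
  st : S
  ac : A
  bc : B

instance {S A B : Type} : MeasurableSpace (Step S A B) := ⊤

/-- A history: the list of past steps together with the current (final) state. -/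
abbrev Hist (S A B : Type) := List (Step S A B) × S

/-- An infinite play. -/
abbrev Play (S A B : Type) := ℕ → Step S A B

/-- A concurrent stochastic game: action sets for Max and Min at each state
(nonempty; countability is imposed via `Countable` instances on `S`, `A`, `B`),
and a transition probability distribution for each state and pair of actions. -/
structure Game (S A B : Type) where
  actA : S → Set A
  actB : S → Set B
  actA_nonempty : ∀ s, (actA s).Nonempty
  actB_nonempty : ∀ s, (actB s).Nonempty
  p : S → A → B → PMF S

namespace Game

variable {S A B : Type}

/-- A Max strategy assigns to each history a mixed action on the Max actions
available at the final state of the history. -/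
def IsMaxStrategy (G : Game S A B) (σ : Hist S A B → PMF A) : Prop :=
  ∀ h : Hist S A B, (σ h).support ⊆ G.actA h.2

/-- A Min strategy assigns to each history a mixed action on the Min actions
available at the final state of the history. -/
def IsMinStrategy (G : Game S A B) (π : Hist S A B → PMF B) : Prop :=
  ∀ h : Hist S A B, (π h).support ⊆ G.actB h.2

/-- A sink state: all transitions from it return to it with probability 1. -/
def IsSink (G : Game S A B) (s : S) : Prop := ∀ a b, G.p s a b s = 1

/-- A history is valid if all actions taken in it were available. -/
def ValidHist (G : Game S A B) (h : Hist S A B) : Prop :=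
  ∀ z ∈ h.1, z.ac ∈ G.actA z.st ∧ z.bc ∈ G.actB z.st

/-- Transition function extended to a mixed Max action and a pure Min action. -/
noncomputable def pA (G : Game S A B) (s : S) (α : PMF A) (b : B) : PMF S :=
  α.bind fun a => G.p s a b

/-- Transition function extended to mixed actions of both players. -/
noncomputable def pAB (G : Game S A B) (s : S) (α : PMF A) (β : PMF B) : PMF S :=
  α.bind fun a => β.bind fun b => G.p s a b

/-- The state reached after the current position: the state of the next listed
step, or the given final state if no steps remain. -/
def nextState : List (Step S A B) → S → S
  | [], t => t
  | z :: _, _ => z.st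

/-- Auxiliary recursion computing the probability of a history:
`pre` is the already-consumed prefix, `cur` the current state, and the
remaining steps and final state are processed from the left. -/
noncomputable def histProbAux (G : Game S A B)
    (σ : Hist S A B → PMF A) (π : Hist S A B → PMF B) :
    List (Step S A B) → S → List (Step S A B) → S → ℝ≥0∞
  | _, cur, [], t => if t = cur then 1 else 0
  | pre, cur, z :: rest, t =>
    if z.st = cur then
      σ (pre, cur) z.ac * π (pre, cur) z.bc *
        G.p z.st z.ac z.bc (nextState rest t) *
        histProbAux G σ π (pre ++ [z]) (nextState rest t) rest t
    else 0

/-- The probability of (the cylinder of) a history under strategies σ, π from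
initial state `s0`. -/
noncomputable def histProb (G : Game S A B)
    (σ : Hist S A B → PMF A) (π : Hist S A B → PMF B) (s0 : S) (h : Hist S A B) : ℝ≥0∞ :=
  G.histProbAux σ π [] s0 h.1 h.2

end Game

/-- The cylinder set of plays extending a given history. -/
def cylinder {S A B : Type} (h : Hist S A B) : Set (Play S A B) :=
  {ω | (∀ i : Fin h.1.length, ω i = h.1.get i) ∧ (ω h.1.length).st = h.2}

/-- A strategy is memoryless if its choice depends only on the final state. -/
def Memoryless {S A B X : Type} (σ : Hist S A B → X) : Prop :=
  ∀ h h' : Hist S A B, h.2 = h'.2 → σ h = σ h'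

/-- The event that the play visits state `t`. -/
def Reaches {S A B : Type} (t : S) : Set (Play S A B) := {ω | ∃ i, (ω i).st = t}

/-- The event that the play never visits state `t`. -/
def Avoids {S A B : Type} (t : S) : Set (Play S A B) := {ω | ∀ i, (ω i).st ≠ t}

/-- The event that the play visits state `t` within at most `n` steps. -/
def ReachesWithin {S A B : Type} (t : S) (n : ℕ) : Set (Play S A B) :=
  {ω | ∃ i ≤ n, (ω i).st = t}

/-- Expectation of `v : S → ℝ≥0∞` with respect to a distribution on `S`. -/
noncomputable def expE {S : Type} (μ : PMF S) (v : S → ℝ≥0∞) : ℝ≥0∞ := ∑' t, μ t * v t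

/-- Expectation of a real-valued `v` with respect to a distribution on `S`. -/
noncomputable def expR {S : Type} (μ : PMF S) (v : S → ℝ) : ℝ := ∑' t, (μ t).toReal * v t

/-- The mass a distribution assigns to a set of states. -/
noncomputable def massOf {S : Type} (μ : PMF S) (T : Set S) : ℝ≥0∞ :=
  ∑' t, T.indicator (⇑μ) t

namespace Game

variable {S A B : Type}

/-- `μ` is the probability measure on plays induced by strategies σ, π from
initial state `s0` (characterized on cylinder sets, by Carathéodory's
extension theorem). -/
def IsPlayMeasure (G : Game S A B) (σ : Hist S A B → PMF A) (π : Hist S A B → PMF B)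
    (s0 : S) (μ : MeasureTheory.Measure (Play S A B)) : Prop :=
  MeasureTheory.IsProbabilityMeasure μ ∧
    ∀ h : Hist S A B, μ (cylinder h) = G.histProb σ π s0 h

/-- The (lower) value `sup_σ inf_π P_{s,σ,π}(E)` of objective `E` from state `s`,
relative to the family `P` of induced play measures. -/
noncomputable def val (G : Game S A B)
    (P : (Hist S A B → PMF A) → (Hist S A B → PMF B) → S →
      MeasureTheory.Measure (Play S A B))
    (E : Set (Play S A B)) (s : S) : ℝ≥0∞ :=
  ⨆ σ ∈ {σ | G.IsMaxStrategy σ}, ⨅ π ∈ {π | G.IsMinStrategy π}, P σ π s E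

/-- The set of states from which Max has an optimal strategy for `Reaches top`. -/
def OptStates (G : Game S A B)
    (P : (Hist S A B → PMF A) → (Hist S A B → PMF B) → S →
      MeasureTheory.Measure (Play S A B))
    (top : S) : Set S :=
  {s | ∃ σ, G.IsMaxStrategy σ ∧ ∀ π, G.IsMinStrategy π →
      P σ π s (Reaches top) ≥ G.val P (Reaches top) s}

/-- A mixed Max action `α` at `s` is optimality-preserving if every Min action
gives expected value at least the value of `s`, and in case of equality the
successor distribution is supported on states admitting optimal strategies. -/
def OptPreserving (G : Game S A B)
    (P : (Hist S A B → PMF A) → (Hist S A B → PMF B) → S →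
      MeasureTheory.Measure (Play S A B))
    (top : S) (s : S) (α : PMF A) : Prop :=
  ∀ b ∈ G.actB s,
    G.val P (Reaches top) s ≤ expE (G.pA s α b) (G.val P (Reaches top)) ∧
    (expE (G.pA s α b) (G.val P (Reaches top)) = G.val P (Reaches top) s →
      (G.pA s α b).support ⊆ G.OptStates P top)

/-- A Min action `b` is value-preserving at `s` against the mixed action `α`. -/
def ValuePres (G : Game S A B)
    (P : (Hist S A B → PMF A) → (Hist S A B → PMF B) → S →
      MeasureTheory.Measure (Play S A B))
    (top : S) (s : S) (α : PMF A) (b : B) : Prop :=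
  expE (G.pA s α b) (G.val P (Reaches top)) = G.val P (Reaches top) s

end Game

/-! ### Expectations -/

theorem expE_mono {S : Type} (μ : PMF S) {f g : S → ℝ≥0∞} (h : ∀ t, f t ≤ g t) :
    expE μ f ≤ expE μ g :=
  ENNReal.tsum_le_tsum fun t => mul_le_mul_right (h t) _

theorem expE_const {S : Type} (μ : PMF S) (c : ℝ≥0∞) : expE μ (fun _ => c) = c := by
  rw [expE, ENNReal.tsum_mul_right, PMF.tsum_coe, one_mul]

theorem expE_add {S : Type} (μ : PMF S) (f g : S → ℝ≥0∞) :
    expE μ (fun t => f t + g t) = expE μ f + expE μ g := by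
  simp only [expE, mul_add, ENNReal.tsum_add]

theorem expE_congr_of_support {S : Type} (μ : PMF S) {f g : S → ℝ≥0∞}
    (h : ∀ t ∈ μ.support, f t = g t) : expE μ f = expE μ g := by
  refine tsum_congr fun t => ?_
  by_cases ht : μ t = 0
  · simp [ht]
  · rw [h t ((PMF.mem_support_iff _ _).2 ht)]

theorem expE_le_const {S : Type} (μ : PMF S) {f : S → ℝ≥0∞} {c : ℝ≥0∞} (h : ∀ t, f t ≤ c) :
    expE μ f ≤ c :=
  (expE_mono μ h).trans_eq (expE_const μ c)

/-- Two ordered functions with the same finite expectation agree on the support. -/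
theorem eq_of_expE_le {S : Type} (μ : PMF S) {f g : S → ℝ≥0∞} (hfg : ∀ t, f t ≤ g t)
    (hle : expE μ g ≤ expE μ f) (hfin : expE μ f ≠ ∞) {t : S} (ht : t ∈ μ.support) :
    f t = g t := by
  by_contra hne
  have hlt : f t < g t := lt_of_le_of_ne (hfg t) hne
  refine hle.not_gt (ENNReal.tsum_lt_tsum (i := t) hfin (fun a => mul_le_mul_right (hfg a) _) ?_)
  exact ENNReal.mul_lt_mul_right ((PMF.mem_support_iff _ _).1 ht) (μ.apply_ne_top t) hlt

theorem expE_iSup {S : Type} [Finite S] (μ : PMF S) {f : ℕ → S → ℝ≥0∞} (hf : Monotone f) :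
    expE μ (fun t => ⨆ n, f n t) = ⨆ n, expE μ (f n) := by
  cases nonempty_fintype S
  simp only [expE, tsum_fintype, ENNReal.mul_iSup]
  exact ENNReal.finsetSum_iSup_of_monotone fun t n m h => mul_le_mul_right (hf h t) _

/-- On a finite index set, a monotone supremum commutes with the infimum. -/
theorem biInf_iSup_of_monotone {B : Type} {s : Set B} (hs : s.Finite)
    {f : ℕ → B → ℝ≥0∞} (hf : ∀ b, Monotone fun n => f n b) :
    (⨅ b ∈ s, ⨆ n, f n b) = ⨆ n, ⨅ b ∈ s, f n b := by
  apply le_antisymm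
  · refine le_of_forall_lt fun c hc => ?_
    have h1 : ∀ b ∈ s, ∃ n, c < f n b := fun b hb =>
      lt_iSup_iff.1 (hc.trans_le (iInf₂_le b hb))
    choose! N hN using h1
    obtain ⟨m, hm⟩ := (hs.image N).bddAbove
    rcases s.eq_empty_or_nonempty with rfl | hne
    · simpa using hc
    · obtain ⟨b, hb, hbm⟩ := Set.exists_min_image s (f m) hs hne
      refine lt_of_lt_of_le ?_ (le_iSup _ m)
      refine lt_of_lt_of_le ?_ (le_iInf₂ hbm)
      exact (hN b hb).trans_le (hf b (hm (Set.mem_image_of_mem N hb)))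
  · exact iSup_le fun n => iInf₂_mono fun b _ => le_iSup (fun n => f n b) n

theorem exists_biInf_eq {B : Type} {s : Set B} (hs : s.Finite) (hne : s.Nonempty)
    (f : B → ℝ≥0∞) : ∃ b ∈ s, f b = ⨅ b ∈ s, f b := by
  obtain ⟨b, hb, hbm⟩ := Set.exists_min_image s f hs hne
  exact ⟨b, hb, le_antisymm (le_iInf₂ hbm) (iInf₂_le b hb)⟩

namespace Game

variable {S A B : Type}

theorem expE_pA (G : Game S A B) (s : S) (α : PMF A) (b : B) (f : S → ℝ≥0∞) :
    expE (G.pA s α b) f = expE α fun a => expE (G.p s a b) f := by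
  simp only [expE, pA, PMF.bind_apply, ← ENNReal.tsum_mul_right, ← ENNReal.tsum_mul_left]
  rw [ENNReal.tsum_comm]
  simp only [mul_assoc]

/-! ### Strategies after a prefix, and bounded reachability -/

/-- The continuation of a strategy after the steps `l` have been played. -/
def shift {X : Type} (σ : Hist S A B → X) (l : List (Step S A B)) : Hist S A B → X :=
  fun h => σ (l ++ h.1, h.2)

theorem shift_nil {X : Type} (σ : Hist S A B → X) : shift σ [] = σ := rfl

theorem shift_shift {X : Type} (σ : Hist S A B → X) (l l' : List (Step S A B)) :
    shift (shift σ l) l' = shift σ (l ++ l') := by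
  funext h; simp [shift]

theorem IsMaxStrategy.shift {G : Game S A B} {σ : Hist S A B → PMF A} (h : G.IsMaxStrategy σ)
    (l : List (Step S A B)) : G.IsMaxStrategy (Game.shift σ l) := fun _ => h _

theorem IsMinStrategy.shift {G : Game S A B} {π : Hist S A B → PMF B} (h : G.IsMinStrategy π)
    (l : List (Step S A B)) : G.IsMinStrategy (Game.shift π l) := fun _ => h _

/-- The probability of visiting `top` within `n` steps from `s`. -/
noncomputable def reachN (G : Game S A B) (top : S) :
    ℕ → (Hist S A B → PMF A) → (Hist S A B → PMF B) → S → ℝ≥0∞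
  | 0, _, _, s => if s = top then 1 else 0
  | n + 1, σ, π, s =>
    if s = top then 1 else
      ∑' a, σ ([], s) a * ∑' b, π ([], s) b *
        expE (G.p s a b) fun t => reachN G top n (shift σ [⟨s, a, b⟩]) (shift π [⟨s, a, b⟩]) t

/-- The probability of visiting `top` from `s`. -/
noncomputable def reach (G : Game S A B) (top : S) (σ : Hist S A B → PMF A)
    (π : Hist S A B → PMF B) (s : S) : ℝ≥0∞ :=
  ⨆ n, G.reachN top n σ π s

theorem reachN_top (G : Game S A B) (top : S) (n : ℕ) (σ : Hist S A B → PMF A)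
    (π : Hist S A B → PMF B) : G.reachN top n σ π top = 1 := by
  cases n <;> simp [reachN]

theorem reach_top (G : Game S A B) (top : S) (σ : Hist S A B → PMF A)
    (π : Hist S A B → PMF B) : G.reach top σ π top = 1 := by
  simp [reach, reachN_top]

theorem reachN_succ_of_pure (G : Game S A B) {top s : S} (hs : s ≠ top) (n : ℕ)
    (σ : Hist S A B → PMF A) (π : Hist S A B → PMF B) {b : B} (hb : π ([], s) = PMF.pure b) :
    G.reachN top (n + 1) σ π s = ∑' a, σ ([], s) a *
      expE (G.p s a b) fun t =>
        G.reachN top n (shift σ [⟨s, a, b⟩]) (shift π [⟨s, a, b⟩]) t := by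
  rw [reachN, if_neg hs]
  refine tsum_congr fun a => ?_
  rw [hb, tsum_eq_single b]
  · simp
  · intro b' hb'
    simp [PMF.pure_apply, hb']

theorem reachN_congr (G : Game S A B) (top : S) (n : ℕ) :
    ∀ (σ : Hist S A B → PMF A) (π π' : Hist S A B → PMF B) (s : S),
      (∀ h : Hist S A B, nextState h.1 h.2 = s → π h = π' h) →
      G.reachN top n σ π s = G.reachN top n σ π' s := by
  induction n with
  | zero => intros; rfl
  | succ n ih =>
    intro σ π π' s h
    simp only [reachN]
    rw [h ([], s) rfl]
    congr 1
    refine tsum_congr fun a => ?_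
    congr 1
    refine tsum_congr fun b => ?_
    congr 2
    funext t
    exact ih _ _ _ _ fun h' _ => h _ rfl

end Game

namespace Game

variable {S A B : Type}

/-! ### The play measure and bounded reachability -/

theorem histProbAux_append (G : Game S A B) (σ : Hist S A B → PMF A) (π : Hist S A B → PMF B)
    (z : Step S A B) (t : S) (l : List (Step S A B)) :
    ∀ (pre : List (Step S A B)) (cur : S),
      G.histProbAux σ π pre cur (l ++ [z]) t =
        G.histProbAux σ π pre cur l z.st *
          (σ (pre ++ l, z.st) z.ac * π (pre ++ l, z.st) z.bc * G.p z.st z.ac z.bc t) := by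
  induction l with
  | nil =>
    intro pre cur
    by_cases h : z.st = cur
    · simp [histProbAux, nextState, h]
    · simp [histProbAux, h]
  | cons y l ih =>
    intro pre cur
    have hn : nextState (l ++ [z]) t = nextState l z.st := by cases l <;> rfl
    by_cases h : y.st = cur
    · simp only [List.cons_append, histProbAux, h, if_true, hn, ih, List.append_assoc,
        List.nil_append, mul_assoc]
    · simp [histProbAux, h]

theorem histProb_append (G : Game S A B) (σ : Hist S A B → PMF A) (π : Hist S A B → PMF B)
    (s₀ : S) (l : List (Step S A B)) (z : Step S A B) (t : S) :
    G.histProb σ π s₀ (l ++ [z], t) = G.histProb σ π s₀ (l, z.st) *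
      (σ (l, z.st) z.ac * π (l, z.st) z.bc * G.p z.st z.ac z.bc t) := by
  simpa [histProb] using G.histProbAux_append σ π z t l [] s₀

end Game

theorem mem_cylinder_append {S A B : Type} {l : List (Step S A B)} {z : Step S A B} {t : S}
    {ω : Play S A B} :
    ω ∈ cylinder (l ++ [z], t) ↔
      ω ∈ cylinder (l, z.st) ∧ ω l.length = z ∧ (ω (l.length + 1)).st = t := by
  have key : (∀ i : Fin (l ++ [z]).length, ω i = (l ++ [z]).get i) ↔
      (∀ i : Fin l.length, ω i = l.get i) ∧ ω l.length = z := by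
    constructor
    · intro h
      refine ⟨fun i => ?_, ?_⟩
      · have := h ⟨i, by simp⟩
        simpa using this
      · have := h ⟨l.length, by simp⟩
        simpa using this
    · rintro ⟨h1, h2⟩ ⟨i, hi⟩
      rcases Nat.lt_or_ge i l.length with h | h
      · simpa [List.getElem_append, h] using h1 ⟨i, h⟩
      · have : i = l.length := by simp at hi; omega
        subst this
        simpa using h2
  have hlen : (l ++ [z]).length = l.length + 1 := by simp
  simp only [cylinder, Set.mem_ofPred_eq, key, hlen]
  constructor
  · rintro ⟨⟨h1, h2⟩, h3⟩
    exact ⟨⟨h1, by rw [h2]⟩, h2, h3⟩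
  · rintro ⟨⟨h1, _⟩, h2, h3⟩
    exact ⟨⟨h1, h2⟩, h3⟩

theorem measurableSet_coord {S A B : Type} (i : ℕ) (s : Set (Step S A B)) :
    MeasurableSet ((fun ω : Play S A B => ω i) ⁻¹' s) :=
  measurable_pi_apply i MeasurableSpace.measurableSet_top

theorem measurableSet_cylinder {S A B : Type} (h : Hist S A B) : MeasurableSet (cylinder h) := by
  have : cylinder h = (⋂ i : Fin h.1.length, (fun ω : Play S A B => ω i) ⁻¹' {h.1.get i}) ∩
      (fun ω : Play S A B => ω h.1.length) ⁻¹' {z | z.st = h.2} := by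
    ext ω; simp [cylinder]
  rw [this]
  exact (MeasurableSet.iInter fun i => measurableSet_coord _ _).inter (measurableSet_coord _ _)

/-- The event that `top` is visited between times `k` and `k + n`. -/
def VisitsFrom {S A B : Type} (top : S) (k n : ℕ) : Set (Play S A B) :=
  {ω | ∃ i ≤ n, (ω (k + i)).st = top}

theorem measurableSet_visitsFrom {S A B : Type} (top : S) (k n : ℕ) :
    MeasurableSet (VisitsFrom top k n : Set (Play S A B)) := by
  have : (VisitsFrom top k n : Set (Play S A B)) =
      ⋃ i ∈ Set.Iic n, (fun ω : Play S A B => ω (k + i)) ⁻¹' {z | z.st = top} := by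
    ext ω; simp [VisitsFrom]
  rw [this]
  exact MeasurableSet.biUnion (Set.to_countable _) fun i _ => measurableSet_coord _ _

namespace Game

variable {S A B : Type}

theorem measure_cylinder_inter_visitsFrom [Countable S] [Countable A] [Countable B]
    (G : Game S A B) (top : S) {σ : Hist S A B → PMF A} {π : Hist S A B → PMF B} {s₀ : S}
    {μ : MeasureTheory.Measure (Play S A B)} (hμ : G.IsPlayMeasure σ π s₀ μ) (n : ℕ) :
    ∀ (l : List (Step S A B)) (s : S),
      μ (cylinder (l, s) ∩ VisitsFrom top l.length n) =
        μ (cylinder (l, s)) * G.reachN top n (shift σ l) (shift π l) s := by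
  have htop : ∀ n (l : List (Step S A B)),
      μ (cylinder (l, top) ∩ VisitsFrom top l.length n) = μ (cylinder (l, top)) := by
    intro n l
    congr 1
    refine Set.inter_eq_left.2 fun ω hω => ⟨0, Nat.zero_le _, hω.2⟩
  induction n with
  | zero =>
    intro l s
    by_cases hs : s = top
    · subst hs
      rw [htop, reachN_top, mul_one]
    · rw [reachN, if_neg hs, mul_zero]
      have : cylinder (l, s) ∩ VisitsFrom top l.length 0 = (∅ : Set (Play S A B)) := by
        ext ω
        simp only [Set.mem_inter_iff, Set.mem_empty_iff_false, iff_false, not_and]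
        rintro ⟨_, h2⟩ ⟨i, hi, h3⟩
        obtain rfl : i = 0 := by omega
        exact hs (h2.symm.trans h3)
      rw [this, MeasureTheory.measure_empty]
  | succ n ih =>
    intro l s
    by_cases hs : s = top
    · subst hs
      rw [htop, reachN_top, mul_one]
    have hU : cylinder (l, s) ∩ VisitsFrom top l.length (n + 1) =
        ⋃ x : A × B × S, cylinder (l ++ [⟨s, x.1, x.2.1⟩], x.2.2) ∩
          (VisitsFrom top (l ++ [(⟨s, x.1, x.2.1⟩ : Step S A B)]).length n : Set (Play S A B)) := by
      ext ω
      simp only [Set.mem_inter_iff, Set.mem_iUnion, mem_cylinder_append, Prod.exists]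
      constructor
      · rintro ⟨hc, i, hi, hit⟩
        refine ⟨(ω l.length).ac, (ω l.length).bc, (ω (l.length + 1)).st, ⟨hc, ?_, rfl⟩, ?_⟩
        · have := hc.2
          simp only at this
          rw [← this]
        · cases i with
          | zero => exact absurd (hc.2.symm.trans hit) hs
          | succ i =>
            refine ⟨i, by omega, ?_⟩
            rw [← hit]
            simp [add_comm, add_left_comm]
      · rintro ⟨a, b, t, ⟨hc, _, _⟩, i, hi, hit⟩
        refine ⟨hc, i + 1, by omega, ?_⟩
        rw [← hit]
        simp [add_comm, add_left_comm]
    rw [hU, MeasureTheory.measure_iUnion]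
    · simp only [ih, hμ.2, histProb_append]
      rw [reachN, if_neg hs, ENNReal.tsum_prod', ← ENNReal.tsum_mul_left]
      refine tsum_congr fun a => ?_
      rw [ENNReal.tsum_prod', ← ENNReal.tsum_mul_left, ← ENNReal.tsum_mul_left]
      refine tsum_congr fun b => ?_
      rw [expE, ← ENNReal.tsum_mul_left, ← ENNReal.tsum_mul_left, ← ENNReal.tsum_mul_left]
      refine tsum_congr fun t => ?_
      simp only [shift_shift]
      simp only [shift, List.append_nil]
      ring
    · rintro ⟨a, b, t⟩ ⟨a', b', t'⟩ hne
      refine Set.disjoint_left.2 fun ω h h' => hne ?_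
      have h1 := (mem_cylinder_append.1 h.1).2
      have h2 := (mem_cylinder_append.1 h'.1).2
      have h3 := h1.1.symm.trans h2.1
      have h4 := h1.2.symm.trans h2.2
      simp only [Step.mk.injEq, true_and] at h3
      simp only at h4
      rw [h3.1, h3.2, h4]
    · exact fun x => (measurableSet_cylinder _).inter (measurableSet_visitsFrom _ _ _)

theorem IsPlayMeasure.measure_reaches [Countable S] [Countable A] [Countable B]
    {G : Game S A B} {σ : Hist S A B → PMF A} {π : Hist S A B → PMF B} {s₀ : S}
    {μ : MeasureTheory.Measure (Play S A B)} (hμ : G.IsPlayMeasure σ π s₀ μ) (top : S) :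
    μ (Reaches top) = G.reach top σ π s₀ := by
  have := hμ.1
  have hc : μ (cylinder ([], s₀)) = 1 := by
    rw [hμ.2]; simp [histProb, histProbAux]
  have hU : (Reaches top : Set (Play S A B)) = ⋃ n, VisitsFrom top 0 n := by
    ext ω
    simp only [Reaches, VisitsFrom, Set.mem_ofPred_eq, Set.mem_iUnion, zero_add]
    exact ⟨fun ⟨i, hi⟩ => ⟨i, i, le_rfl, hi⟩, fun ⟨_, i, _, hi⟩ => ⟨i, hi⟩⟩
  have hmono : Monotone fun n => (VisitsFrom top 0 n : Set (Play S A B)) :=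
    fun n m h ω ⟨i, hi, hω⟩ => ⟨i, hi.trans h, hω⟩
  rw [hU, hmono.measure_iUnion, reach]
  refine iSup_congr fun n => ?_
  have h1 := G.measure_cylinder_inter_visitsFrom top hμ n [] s₀
  rw [hc, one_mul, List.length_nil, shift_nil, shift_nil] at h1
  rw [← h1]
  have h0 : μ (cylinder ([], s₀) : Set (Play S A B))ᶜ = 0 := by
    rw [MeasureTheory.prob_compl_eq_zero_iff (measurableSet_cylinder _), hc]
  rw [Set.inter_comm, MeasureTheory.measure_inter_conull h0]

end Game

namespace Game

variable {S A B : Type}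

/-! ### The one-step operator and its least fixed point -/

/-- The optimal one-step expectation `sup_α inf_b E[u]` at a state. -/
noncomputable def bellman (G : Game S A B) (u : S → ℝ≥0∞) (s : S) : ℝ≥0∞ :=
  ⨆ α ∈ {α : PMF A | α.support ⊆ G.actA s}, ⨅ b ∈ G.actB s, expE (G.pA s α b) u

theorem bellman_mono (G : Game S A B) {u w : S → ℝ≥0∞} (h : u ≤ w) (s : S) :
    G.bellman u s ≤ G.bellman w s :=
  iSup₂_mono fun _ _ => iInf₂_mono fun _ _ => expE_mono _ h

theorem bellman_le_one (G : Game S A B) {u : S → ℝ≥0∞} (h : ∀ s, u s ≤ 1) (s : S) :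
    G.bellman u s ≤ 1 := by
  obtain ⟨b, hb⟩ := G.actB_nonempty s
  exact iSup₂_le fun α _ => (iInf₂_le b hb).trans (expE_le_const _ h)

theorem bellman_iSup [Finite S] (G : Game S A B) (hB : ∀ s, (G.actB s).Finite)
    {u : ℕ → S → ℝ≥0∞} (hu : Monotone u) (s : S) :
    G.bellman (fun t => ⨆ n, u n t) s = ⨆ n, G.bellman (u n) s := by
  simp only [bellman, expE_iSup _ hu]
  have : ∀ α : PMF A, (⨅ b ∈ G.actB s, ⨆ n, expE (G.pA s α b) (u n)) =
      ⨆ n, ⨅ b ∈ G.actB s, expE (G.pA s α b) (u n) := fun α =>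
    biInf_iSup_of_monotone (hB s) fun b n m h => expE_mono _ (hu h)
  simp only [this]
  refine le_antisymm (iSup₂_le fun α hα => iSup_mono fun n => ?_)
    (iSup_le fun n => iSup₂_mono fun α _ => ?_)
  · exact le_iSup₂ (f := fun (α : PMF A) (_ : α ∈ {α : PMF A | α.support ⊆ G.actA s}) =>
      ⨅ b ∈ G.actB s, expE (G.pA s α b) (u n)) α hα
  · exact le_iSup (fun n => ⨅ b ∈ G.actB s, expE (G.pA s α b) (u n)) n

/-- The least solution of the optimality equation for reaching `top`. -/
noncomputable def valueLfp (G : Game S A B) (top : S) : S → ℝ≥0∞ :=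
  OrderHom.lfp
    { toFun := fun w s => if s = top then 1 else G.bellman w s
      monotone' := fun u w h s => by
        dsimp only
        split_ifs
        · exact le_rfl
        · exact G.bellman_mono h s }

theorem valueLfp_eq (G : Game S A B) (top s : S) :
    G.valueLfp top s = if s = top then 1 else G.bellman (G.valueLfp top) s :=
  (congrFun (OrderHom.map_lfp _) s).symm

theorem valueLfp_top (G : Game S A B) (top : S) : G.valueLfp top top = 1 := by
  rw [valueLfp_eq, if_pos rfl]

theorem bellman_valueLfp (G : Game S A B) {top s : S} (hs : s ≠ top) :
    G.bellman (G.valueLfp top) s = G.valueLfp top s := by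
  rw [valueLfp_eq G top s, if_neg hs]

theorem valueLfp_le (G : Game S A B) {top : S} {w : S → ℝ≥0∞} (h1 : 1 ≤ w top)
    (h2 : ∀ s, s ≠ top → G.bellman w s ≤ w s) : G.valueLfp top ≤ w := by
  refine OrderHom.lfp_le _ fun s => ?_
  change (if s = top then 1 else G.bellman w s) ≤ w s
  split_ifs with hs
  · rwa [hs]
  · exact h2 s hs

theorem valueLfp_le_one (G : Game S A B) (top s : S) : G.valueLfp top s ≤ 1 :=
  G.valueLfp_le (w := fun _ => 1) le_rfl
    (fun s _ => G.bellman_le_one (fun _ => le_rfl) s) s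

theorem valueLfp_ne_top (G : Game S A B) (top s : S) : G.valueLfp top s ≠ ∞ :=
  ((G.valueLfp_le_one top s).trans_lt ENNReal.one_lt_top).ne

/-- Min has a response to every Max strategy that keeps the reachability probability below the
least fixed point, from every initial state. -/
theorem exists_reach_le_valueLfp (G : Game S A B) (hB : ∀ s, (G.actB s).Finite) (top : S)
    {σ : Hist S A B → PMF A} (hσ : G.IsMaxStrategy σ) :
    ∃ π, G.IsMinStrategy π ∧ ∀ s, G.reach top σ π s ≤ G.valueLfp top s := by
  have hex : ∀ h : Hist S A B, ∃ b ∈ G.actB h.2,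
      h.2 ≠ top → expE (G.pA h.2 (σ h) b) (G.valueLfp top) ≤ G.valueLfp top h.2 := by
    intro h
    obtain ⟨b, hb, hbm⟩ := exists_biInf_eq (hB h.2) (G.actB_nonempty h.2)
      fun b => expE (G.pA h.2 (σ h) b) (G.valueLfp top)
    refine ⟨b, hb, fun hs => ?_⟩
    rw [hbm, ← G.bellman_valueLfp hs]
    exact le_iSup₂ (f := fun (α : PMF A) (_ : α ∈ {α : PMF A | α.support ⊆ G.actA h.2}) =>
      ⨅ b ∈ G.actB h.2, expE (G.pA h.2 α b) (G.valueLfp top)) (σ h) (hσ h)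
  choose β hβ hβle using hex
  refine ⟨fun h => PMF.pure (β h), fun h => ?_, fun s => iSup_le fun n => ?_⟩
  · simpa using hβ h
  have key : ∀ (n : ℕ) (l : List (Step S A B)) (s : S),
      G.reachN top n (shift σ l) (shift (fun h => PMF.pure (β h)) l) s ≤ G.valueLfp top s := by
    intro n
    induction n with
    | zero =>
      intro l s
      by_cases hs : s = top
      · subst hs; rw [reachN_top, valueLfp_top]
      · simp [reachN, hs]
    | succ n ih =>
      intro l s
      by_cases hs : s = top
      · subst hs; rw [reachN_top, valueLfp_top]
      · rw [reachN_succ_of_pure G hs n _ _ (b := β (l ++ [], s)) rfl]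
        refine le_trans ?_ (hβle (l ++ [], s) hs)
        rw [expE_pA]
        refine ENNReal.tsum_le_tsum fun a => mul_le_mul_right (expE_mono _ fun t => ?_) _
        simp only [shift_shift]
        exact ih _ t
  exact key n [] s

/-! ### Memoryless strategies -/

/-- The probability of reaching `top` within `n` steps when Max plays the mixed actions `α` and
Min minimizes. -/
noncomputable def minReachN (G : Game S A B) (top : S) (α : S → PMF A) : ℕ → S → ℝ≥0∞
  | 0, s => if s = top then 1 else 0
  | n + 1, s => if s = top then 1 else
      ⨅ b ∈ G.actB s, expE (G.pA s (α s) b) (minReachN G top α n)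

/-- The memoryless strategy playing the mixed actions `α`. -/
def memoryless (α : S → PMF A) : Hist S A B → PMF A := fun h => α h.2

theorem minReachN_le_reachN (G : Game S A B) (top : S) (α : S → PMF A) (n : ℕ) :
    ∀ {π : Hist S A B → PMF B} (_ : G.IsMinStrategy π) (s : S),
      G.minReachN top α n s ≤ G.reachN top n (memoryless α) π s := by
  induction n with
  | zero => intro π _ s; exact le_rfl
  | succ n ih =>
    intro π hπ s
    by_cases hs : s = top
    · simp [minReachN, reachN, hs]
    rw [minReachN, reachN, if_neg hs, if_neg hs]
    have hterm : ∀ b, π ([], s) b * ⨅ b ∈ G.actB s, expE (G.pA s (α s) b) (G.minReachN top α n) ≤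
        π ([], s) b * expE (G.pA s (α s) b) (G.minReachN top α n) := by
      intro b
      by_cases hb : π ([], s) b = 0
      · simp [hb]
      · exact mul_le_mul_right (iInf₂_le b (hπ _ ((PMF.mem_support_iff _ _).2 hb))) _
    calc (⨅ b ∈ G.actB s, expE (G.pA s (α s) b) (G.minReachN top α n))
        = ∑' b, π ([], s) b * ⨅ b ∈ G.actB s, expE (G.pA s (α s) b) (G.minReachN top α n) := by
          rw [ENNReal.tsum_mul_right, PMF.tsum_coe, one_mul]
      _ ≤ ∑' b, π ([], s) b * expE (G.pA s (α s) b) (G.minReachN top α n) :=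
          ENNReal.tsum_le_tsum hterm
      _ = ∑' a, α s a * ∑' b, π ([], s) b * expE (G.p s a b) (G.minReachN top α n) := by
          have hp : ∀ b, expE (G.pA s (α s) b) (G.minReachN top α n) =
              ∑' a, α s a * expE (G.p s a b) (G.minReachN top α n) := fun b => G.expE_pA s _ b _
          simp only [hp, ← ENNReal.tsum_mul_left]
          rw [ENNReal.tsum_comm]
          simp only [mul_left_comm]
      _ ≤ _ := by
          refine ENNReal.tsum_le_tsum fun a => mul_le_mul_right
            (ENNReal.tsum_le_tsum fun b => mul_le_mul_right (expE_mono _ fun t => ?_) _) _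
          exact ih (hπ.shift _) t

theorem minReachN_le_one (G : Game S A B) (top : S) (α : S → PMF A) (n : ℕ) :
    ∀ s, G.minReachN top α n s ≤ 1 := by
  induction n with
  | zero => intro s; rw [minReachN]; split_ifs <;> simp
  | succ n ih =>
    intro s
    rw [minReachN]
    split_ifs
    · exact le_rfl
    · obtain ⟨b, hb⟩ := G.actB_nonempty s
      exact (iInf₂_le b hb).trans (expE_le_const _ ih)

theorem monotone_minReachN (G : Game S A B) (top : S) (α : S → PMF A) :
    Monotone (G.minReachN top α) := by
  refine monotone_nat_of_le_succ fun n => ?_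
  induction n with
  | zero =>
    intro s
    by_cases hs : s = top <;> simp [minReachN, hs]
  | succ n ih =>
    intro s
    by_cases hs : s = top
    · simp [minReachN, hs]
    · rw [minReachN, minReachN, if_neg hs, if_neg hs]
      exact iInf₂_mono fun _ _ => expE_mono _ ih

/-- Against the mixed actions `α`, Min can stay in `M` forever. -/
def IsTrap (G : Game S A B) (α : S → PMF A) (M : Set S) : Prop :=
  ∀ s ∈ M, ∃ b ∈ G.actB s, (G.pA s (α s) b).support ⊆ M

theorem minReachN_eq_zero_of_isTrap (G : Game S A B) {top : S} {α : S → PMF A} {M : Set S}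
    (hM : G.IsTrap α M) (htop : top ∉ M) (n : ℕ) : ∀ s ∈ M, G.minReachN top α n s = 0 := by
  induction n with
  | zero =>
    intro s hs
    rw [minReachN, if_neg (ne_of_mem_of_not_mem hs htop)]
  | succ n ih =>
    intro s hs
    obtain ⟨b, hb, hsub⟩ := hM s hs
    rw [minReachN, if_neg (ne_of_mem_of_not_mem hs htop), ← nonpos_iff_eq_zero]
    refine (iInf₂_le b hb).trans ?_
    rw [expE_congr_of_support _ (g := fun _ => 0) fun t ht => ih t (hsub ht), expE_const]

/-- A subharmonic function bounds the reachability probability of a memoryless strategy from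
below, provided that Min has no trap on which it is a positive constant. -/
theorem le_iSup_minReachN [Finite S] (G : Game S A B) (hB : ∀ s, (G.actB s).Finite) (top : S)
    (α : S → PMF A) {u : S → ℝ≥0∞} (hu1 : ∀ s, u s ≤ 1)
    (hsub : ∀ s, s ≠ top → ∀ b ∈ G.actB s, u s ≤ expE (G.pA s (α s) b) u)
    (htrap : ∀ M : Set S, M.Nonempty → top ∉ M → ∀ c, c ≠ 0 → (∀ s ∈ M, u s = c) →
      ¬ G.IsTrap α M) (s : S) :
    u s ≤ ⨆ n, G.minReachN top α n s := by
  set w : S → ℝ≥0∞ := fun s => ⨆ n, G.minReachN top α n s with hw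
  have hwtop : w top = 1 := by
    simp only [hw]
    refine le_antisymm (iSup_le fun n => G.minReachN_le_one _ _ _ _) (le_iSup_of_le 0 ?_)
    simp [minReachN]
  have hw1 : ∀ s, w s ≤ 1 := fun s => iSup_le fun n => G.minReachN_le_one _ _ _ _
  have hwfin : ∀ s, w s ≠ ∞ := fun s => ((hw1 s).trans_lt ENNReal.one_lt_top).ne
  have hattain : ∀ s, s ≠ top → ∃ b ∈ G.actB s, expE (G.pA s (α s) b) w = w s := by
    intro s hs
    obtain ⟨b, hb, hbm⟩ := exists_biInf_eq (hB s) (G.actB_nonempty s)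
      fun b => expE (G.pA s (α s) b) w
    refine ⟨b, hb, ?_⟩
    rw [hbm]
    simp only [hw, expE_iSup _ (G.monotone_minReachN top α)]
    rw [biInf_iSup_of_monotone (hB s) (f := fun n b => expE (G.pA s (α s) b) (G.minReachN top α n))
      fun b n m h => expE_mono _ (G.monotone_minReachN top α h)]
    have hm : Monotone fun n => G.minReachN top α n s := fun n m h =>
      G.monotone_minReachN top α h s
    rw [← hm.iSup_nat_add 1]
    refine iSup_congr fun n => ?_
    rw [minReachN, if_neg hs]
  by_contra hlt
  have : Nonempty S := ⟨s⟩
  obtain ⟨m, hm⟩ := Finite.exists_max fun s => u s - w s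
  set D := u m - w m with hD
  have hDpos : D ≠ 0 := by
    intro h0
    have := hm s
    rw [h0, nonpos_iff_eq_zero, tsub_eq_zero_iff_le] at this
    exact hlt this
  have hDfin : D ≠ ∞ := (tsub_le_self.trans_lt ((hu1 m).trans_lt ENNReal.one_lt_top)).ne
  set M : Set S := {t | u t - w t = D} with hMdef
  have htopM : top ∉ M := by
    intro h
    apply hDpos
    rw [← show u top - w top = D from h, hwtop]
    exact tsub_eq_zero_of_le (hu1 top)
  have huM : ∀ t ∈ M, u t = w t + D := by
    intro t ht
    rw [← show u t - w t = D from ht, add_tsub_cancel_of_le]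
    by_contra hle
    apply hDpos
    rw [← show u t - w t = D from ht]
    exact tsub_eq_zero_of_le (not_le.1 hle).le
  have hTrap : G.IsTrap α M := by
    intro t ht
    have htt : t ≠ top := ne_of_mem_of_not_mem ht htopM
    obtain ⟨b, hb, hbw⟩ := hattain t htt
    refine ⟨b, hb, fun t' ht' => ?_⟩
    have h1 : w t + D ≤ w t + expE (G.pA t (α t) b) fun t => u t - w t := by
      calc w t + D = u t := (huM t ht).symm
        _ ≤ expE (G.pA t (α t) b) u := hsub t htt b hb
        _ ≤ expE (G.pA t (α t) b) fun t => w t + (u t - w t) :=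
            expE_mono _ fun t => le_add_tsub
        _ = _ := by rw [expE_add, hbw]
    have h2 : D ≤ expE (G.pA t (α t) b) fun t => u t - w t :=
      (ENNReal.add_le_add_iff_left (hwfin t)).1 h1
    have h3 : (expE (G.pA t (α t) b) fun t => u t - w t) ≤ D := expE_le_const _ hm
    exact eq_of_expE_le (G.pA t (α t) b) (g := fun _ => D) hm
      (by rw [expE_const]; exact h2) (h3.trans_lt hDfin.lt_top).ne ht'
  refine htrap M ⟨m, rfl⟩ htopM D hDpos (fun t ht => ?_) hTrap
  have hw0 : w t = 0 := by
    simp only [hw, G.minReachN_eq_zero_of_isTrap hTrap htopM _ t ht, iSup_const]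
  rw [huM t ht, hw0, zero_add]

theorem le_reach_memoryless [Finite S] (G : Game S A B) (hB : ∀ s, (G.actB s).Finite) (top : S)
    (α : S → PMF A) {u : S → ℝ≥0∞} (hu1 : ∀ s, u s ≤ 1)
    (hsub : ∀ s, s ≠ top → ∀ b ∈ G.actB s, u s ≤ expE (G.pA s (α s) b) u)
    (htrap : ∀ M : Set S, M.Nonempty → top ∉ M → ∀ c, c ≠ 0 → (∀ s ∈ M, u s = c) →
      ¬ G.IsTrap α M)
    {π : Hist S A B → PMF B} (hπ : G.IsMinStrategy π) (s : S) :
    u s ≤ G.reach top (memoryless α) π s :=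
  (G.le_iSup_minReachN hB top α hu1 hsub htrap s).trans
    (iSup_mono fun n => G.minReachN_le_reachN top α n hπ s)

end Game

namespace Game

variable {S A B : Type}

/-! ### Discounted approximations of the value -/

/-- A sequence of discount factors increasing to one. -/
noncomputable def discount (n : ℕ) : ℝ≥0∞ := 1 - (n : ℝ≥0∞)⁻¹

theorem monotone_discount : Monotone discount := fun n m h =>
  tsub_le_tsub_left (ENNReal.inv_le_inv.2 (by exact_mod_cast h)) _

theorem discount_lt_one (n : ℕ) : discount n < 1 :=
  ENNReal.sub_lt_self ENNReal.one_ne_top one_ne_zero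
    (ENNReal.inv_ne_zero.2 (ENNReal.natCast_ne_top n))

theorem iSup_discount : ⨆ n, discount n = 1 := by
  refine tendsto_nhds_unique (tendsto_atTop_iSup monotone_discount) ?_
  have := ENNReal.Tendsto.sub (tendsto_const_nhds (x := (1 : ℝ≥0∞)))
    ENNReal.tendsto_inv_nat_nhds_zero (Or.inl ENNReal.one_ne_top)
  rw [tsub_zero] at this
  exact this

/-- Functions that agree with the least fixed point on `O`, increase to it elsewhere, and are
strictly improved by the one-step operator wherever they are positive outside `O`. -/
theorem exists_discounted [Finite S] (G : Game S A B) (hB : ∀ s, (G.actB s).Finite) (top : S)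
    {O : Set S} (hO : top ∈ O) :
    ∃ u : ℕ → S → ℝ≥0∞, Monotone u ∧ (∀ n s, u n s ≤ G.valueLfp top s) ∧
      (∀ n, ∀ s ∈ O, u n s = G.valueLfp top s) ∧ (∀ s, ⨆ n, u n s = G.valueLfp top s) ∧
      ∀ n, ∀ s ∉ O, u n s = 0 ∨ u n s < G.bellman (u n) s := by
  set v := G.valueLfp top with hv
  let F : ℕ → (S → ℝ≥0∞) →o (S → ℝ≥0∞) := fun n =>
    { toFun := fun w s => if s ∈ O then v s else discount n * G.bellman w s
      monotone' := fun u w h s => by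
        dsimp only
        split_ifs
        · exact le_rfl
        · exact mul_le_mul_right (G.bellman_mono h s) _ }
  have hF : ∀ n w s, F n w s = if s ∈ O then v s else discount n * G.bellman w s :=
    fun _ _ _ => rfl
  let u : ℕ → S → ℝ≥0∞ := fun n => OrderHom.lfp (F n)
  have hfix : ∀ n s, u n s = if s ∈ O then v s else discount n * G.bellman (u n) s := fun n s =>
    (congrFun (OrderHom.map_lfp (F n)) s).symm
  have hmono : Monotone u := by
    refine fun n m h => OrderHom.lfp.monotone fun w s => ?_
    rw [hF, hF]
    split_ifs
    · exact le_rfl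
    · exact mul_le_mul_left (monotone_discount h) _
  have hle : ∀ n s, u n s ≤ v s := by
    refine fun n => show OrderHom.lfp (F n) ≤ v from OrderHom.lfp_le _ fun s => ?_
    rw [hF]
    split_ifs with hs
    · exact le_rfl
    · rw [hv, ← G.bellman_valueLfp (ne_of_mem_of_not_mem hO hs).symm]
      exact mul_le_of_le_one_left' (discount_lt_one n).le
  have hOeq : ∀ n, ∀ s ∈ O, u n s = v s := fun n s hs => by rw [hfix, if_pos hs]
  refine ⟨u, hmono, hle, hOeq, fun s => ?_, fun n s hs => ?_⟩
  · refine le_antisymm (iSup_le fun n => hle n s) ?_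
    refine G.valueLfp_le (w := fun s => ⨆ n, u n s) ?_ (fun s hs => ?_) s
    · simp only [hOeq _ top hO, iSup_const, hv, valueLfp_top, le_refl]
    · rw [G.bellman_iSup hB hmono]
      refine iSup_le fun k => ?_
      by_cases hsO : s ∈ O
      · simp only [hOeq _ s hsO, iSup_const]
        rw [hv, ← G.bellman_valueLfp hs]
        exact G.bellman_mono (hle k) s
      · rw [← one_mul (G.bellman (u k) s), ← iSup_discount, ENNReal.iSup_mul]
        refine iSup_le fun n => le_iSup_of_le (max n k) ?_
        rw [hfix, if_neg hsO]
        exact mul_le_mul' (monotone_discount (le_max_left _ _))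
          (G.bellman_mono (hmono (le_max_right _ _)) s)
  · rw [or_iff_not_imp_left]
    intro h0
    have hb0 : G.bellman (u n) s ≠ 0 := by
      intro hb
      rw [hfix, if_neg hs, hb, mul_zero] at h0
      exact h0 rfl
    have hb1 : G.bellman (u n) s ≠ ∞ :=
      ((G.bellman_le_one (fun t => (hle n t).trans (G.valueLfp_le_one top t)) s).trans_lt
        ENNReal.one_lt_top).ne
    calc u n s = discount n * G.bellman (u n) s := by rw [hfix, if_neg hs]
      _ < 1 * G.bellman (u n) s := ENNReal.mul_lt_mul_left hb0 hb1 (discount_lt_one n)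
      _ = _ := one_mul _

theorem exists_support_subset (G : Game S A B) (s : S) :
    ∃ α : PMF A, α.support ⊆ G.actA s := by
  obtain ⟨a, ha⟩ := G.actA_nonempty s
  exact ⟨PMF.pure a, by simpa using ha⟩

/-- A value strictly below the one-step operator is exceeded by some mixed action. -/
theorem exists_lt_expE (G : Game S A B) {s : S} {u : S → ℝ≥0∞} {c : ℝ≥0∞}
    (h : c < G.bellman u s) :
    ∃ α : PMF A, α.support ⊆ G.actA s ∧ ∀ b ∈ G.actB s, c < expE (G.pA s α b) u := by
  simp only [bellman, lt_iSup_iff] at h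
  obtain ⟨α, hα, h⟩ := h
  exact ⟨α, hα, fun b hb => h.trans_le (iInf₂_le b hb)⟩

theorem exists_lt_expE_of_eq_zero_or (G : Game S A B) {s : S} {u : S → ℝ≥0∞}
    (h : u s = 0 ∨ u s < G.bellman u s) :
    ∃ α : PMF A, α.support ⊆ G.actA s ∧
      (u s = 0 ∨ ∀ b ∈ G.actB s, u s < expE (G.pA s α b) u) := by
  rcases h with h | h
  · obtain ⟨α, hα⟩ := G.exists_support_subset s
    exact ⟨α, hα, Or.inl h⟩
  · obtain ⟨α, hα, hlt⟩ := G.exists_lt_expE h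
    exact ⟨α, hα, Or.inr hlt⟩

theorem expE_eq_of_support_subset {μ : PMF S} {u : S → ℝ≥0∞} {M : Set S} {c : ℝ≥0∞}
    (hM : ∀ s ∈ M, u s = c) (hμ : μ.support ⊆ M) : expE μ u = c := by
  rw [expE_congr_of_support μ (g := fun _ => c) fun t ht => hM t (hμ ht), expE_const]

theorem val_eq_valueLfp [Finite S] [Countable A] [Countable B] (G : Game S A B) (top : S)
    (hB : ∀ s, (G.actB s).Finite)
    {P : (Hist S A B → PMF A) → (Hist S A B → PMF B) → S →
      MeasureTheory.Measure (Play S A B)}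
    (hP : ∀ σ π s, G.IsMaxStrategy σ → G.IsMinStrategy π → G.IsPlayMeasure σ π s (P σ π s))
    (s : S) : G.val P (Reaches top) s = G.valueLfp top s := by
  refine le_antisymm (iSup₂_le fun σ hσ => ?_) ?_
  · obtain ⟨π, hπ, hle⟩ := G.exists_reach_le_valueLfp hB top hσ
    refine (iInf₂_le π hπ).trans ?_
    rw [(hP σ π s hσ hπ).measure_reaches]
    exact hle s
  · obtain ⟨u, -, hle, htop, hsup, hlt⟩ := G.exists_discounted hB top (Set.mem_singleton top)
    rw [← hsup]
    refine iSup_le fun n => ?_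
    have hα : ∀ s, ∃ α : PMF A, α.support ⊆ G.actA s ∧ (s ≠ top →
        u n s = 0 ∨ ∀ b ∈ G.actB s, u n s < expE (G.pA s α b) (u n)) := by
      intro s
      by_cases hs : s = top
      · obtain ⟨α, hα⟩ := G.exists_support_subset s
        exact ⟨α, hα, fun h => absurd hs h⟩
      · obtain ⟨α, hα, h⟩ := G.exists_lt_expE_of_eq_zero_or (hlt n s hs)
        exact ⟨α, hα, fun _ => h⟩
    choose α hα hlt' using hα
    have hσ : G.IsMaxStrategy (memoryless α) := fun h => hα h.2
    refine le_trans ?_ (le_iSup₂ (f := fun (σ : Hist S A B → PMF A)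
      (_ : σ ∈ {σ | G.IsMaxStrategy σ}) =>
      ⨅ π ∈ {π | G.IsMinStrategy π}, P σ π s (Reaches top)) (memoryless α) hσ)
    refine le_iInf₂ fun π hπ => ?_
    rw [(hP _ π s hσ hπ).measure_reaches]
    refine G.le_reach_memoryless hB top α
      (fun s => (hle n s).trans (G.valueLfp_le_one top s)) (fun s hs b hb => ?_) ?_ hπ s
    · rcases hlt' s hs with h | h
      · rw [h]; exact zero_le
      · exact (h b hb).le
    · rintro M ⟨t, ht⟩ htM c hc hconst hTrap
      obtain ⟨b, hb, hsub⟩ := hTrap t ht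
      rcases hlt' t (ne_of_mem_of_not_mem ht htM) with h | h
      · exact hc ((hconst t ht).symm.trans h)
      · have := h b hb
        rw [expE_eq_of_support_subset hconst hsub, hconst t ht] at this
        exact this.false

end Game

namespace Game

variable {S A B : Type}

/-! ### States with an optimal strategy -/

/-- The strategy `σ` attains the least fixed point from `s` against every Min strategy. -/
def IsOptimalFrom (G : Game S A B) (top : S) (σ : Hist S A B → PMF A) (s : S) : Prop :=
  G.IsMaxStrategy σ ∧ ∀ π, G.IsMinStrategy π → G.valueLfp top s ≤ G.reach top σ π s

/-- The states from which some strategy is optimal. -/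
def optimalStates (G : Game S A B) (top : S) : Set S := {s | ∃ σ, G.IsOptimalFrom top σ s}

theorem top_mem_optimalStates (G : Game S A B) (top : S) : top ∈ G.optimalStates top := by
  choose α hα using G.exists_support_subset
  refine ⟨memoryless α, fun h => hα h.2, fun π _ => ?_⟩
  rw [valueLfp_top, reach_top]

/-- Min can play `b` at `s` and then respond according to the first Max action and the first
successor state. -/
theorem exists_reach_le_of_responses (G : Game S A B) {top s : S} (hs : s ≠ top) {b : B}
    (hb : b ∈ G.actB s) (R : A → S → Hist S A B → PMF B) (hR : ∀ a t, G.IsMinStrategy (R a t)) :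
    ∃ π, G.IsMinStrategy π ∧ ∀ σ : Hist S A B → PMF A,
      G.reach top σ π s ≤ expE (σ ([], s)) fun a => expE (G.p s a b) fun t =>
        G.reach top (shift σ [⟨s, a, b⟩]) (R a t) t := by
  choose β hβ using G.actB_nonempty
  let π : Hist S A B → PMF B
    | ([], t) => PMF.pure (if t = s then b else β t)
    | (z :: l, t) => R z.ac (nextState l t) (l, t)
  refine ⟨π, ?_, fun σ => iSup_le fun n => ?_⟩
  · rintro ⟨_ | ⟨z, l⟩, t⟩
    · simp only [π, PMF.support_pure, Set.singleton_subset_iff]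
      split_ifs with h
      · rwa [h]
      · exact hβ t
    · exact hR _ _ (l, t)
  · cases n with
    | zero => simp [reachN, hs]
    | succ n =>
      rw [reachN_succ_of_pure G hs n σ π (b := b) (by simp [π])]
      refine ENNReal.tsum_le_tsum fun a => mul_le_mul_right (expE_mono _ fun t => ?_) _
      refine le_trans (le_of_eq ?_) (le_iSup _ n)
      refine reachN_congr G top n _ _ _ _ fun h hh => ?_
      simp only [shift, π, List.cons_append, List.nil_append, hh]

theorem IsOptimalFrom.le_expE [Finite S] {G : Game S A B} (hB : ∀ s, (G.actB s).Finite)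
    {top s : S} {σ : Hist S A B → PMF A} (h : G.IsOptimalFrom top σ s) (hs : s ≠ top) {b : B}
    (hb : b ∈ G.actB s) :
    G.valueLfp top s ≤ expE (G.pA s (σ ([], s)) b) (G.valueLfp top) := by
  choose R hR hle using fun a =>
    G.exists_reach_le_valueLfp hB top (h.1.shift [(⟨s, a, b⟩ : Step S A B)])
  obtain ⟨π, hπ, hπle⟩ := G.exists_reach_le_of_responses hs hb (fun a _ => R a) fun a _ => hR a
  rw [expE_pA]
  exact (h.2 π hπ).trans ((hπle σ).trans
    (expE_mono _ fun a => expE_mono _ fun t => hle a t))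

/-- After a value-preserving step, an optimal strategy remains optimal. -/
theorem IsOptimalFrom.shift [Finite S] {G : Game S A B} (hB : ∀ s, (G.actB s).Finite)
    {top s : S} {σ : Hist S A B → PMF A} (h : G.IsOptimalFrom top σ s) (hs : s ≠ top) {b : B}
    (hb : b ∈ G.actB s)
    (heq : expE (G.pA s (σ ([], s)) b) (G.valueLfp top) = G.valueLfp top s)
    {a : A} (ha : a ∈ (σ ([], s)).support) {t : S} (ht : t ∈ (G.p s a b).support) :
    G.IsOptimalFrom top (Game.shift σ [⟨s, a, b⟩]) t := by
  refine ⟨h.1.shift _, fun ρ hρ => ?_⟩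
  by_contra hlt
  rw [not_le] at hlt
  choose R hR hle using fun a =>
    G.exists_reach_le_valueLfp hB top (h.1.shift [(⟨s, a, b⟩ : Step S A B)])
  obtain ⟨π, hπ, hπle⟩ := G.exists_reach_le_of_responses hs hb
    (fun a' t' => if a' = a ∧ t' = t then ρ else R a') fun a' t' => by
      split_ifs
      · exact hρ
      · exact hR a'
  have hbound : ∀ a' t', G.reach top (Game.shift σ [⟨s, a', b⟩])
      (if a' = a ∧ t' = t then ρ else R a') t' ≤ G.valueLfp top t' := by
    intro a' t'
    split_ifs with hc
    · rw [hc.1, hc.2]; exact hlt.le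
    · exact hle a' t'
  have h1 := (h.2 π hπ).trans (hπle σ)
  rw [expE_pA] at heq
  have h2 := eq_of_expE_le _ (fun a' => expE_mono (G.p s a' b) (hbound a'))
    (heq.le.trans h1)
    ((expE_mono _ fun a' => expE_mono _ (hbound a')).trans_lt
      (heq.trans_lt (G.valueLfp_ne_top top s).lt_top)).ne ha
  have h3 := eq_of_expE_le _ (hbound a) h2.ge
    ((expE_le_const _ fun t' => (hbound a t').trans (G.valueLfp_le_one top t')).trans_lt
      ENNReal.one_lt_top).ne ht
  simp only [and_self, if_true] at h3
  exact hlt.ne h3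

/-- The mixed action `α` is available at `s`, does not lose value, and leads only to states with
optimal strategies whenever the value is preserved exactly. -/
def PreservesOptimality (G : Game S A B) (top s : S) (α : PMF A) : Prop :=
  α.support ⊆ G.actA s ∧ ∀ b ∈ G.actB s,
    G.valueLfp top s ≤ expE (G.pA s α b) (G.valueLfp top) ∧
    (expE (G.pA s α b) (G.valueLfp top) = G.valueLfp top s →
      (G.pA s α b).support ⊆ G.optimalStates top)

theorem IsOptimalFrom.preservesOptimality [Finite S] {G : Game S A B}
    (hB : ∀ s, (G.actB s).Finite) {top s : S} {σ : Hist S A B → PMF A}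
    (h : G.IsOptimalFrom top σ s) (hs : s ≠ top) : G.PreservesOptimality top s (σ ([], s)) := by
  refine ⟨h.1 _, fun b hb => ⟨h.le_expE hB hs hb, fun heq t ht => ?_⟩⟩
  obtain ⟨a, ha, hat⟩ := (PMF.mem_support_bind_iff _ _ _).1 ht
  exact ⟨_, h.shift hB hs hb heq ha hat⟩

/-- If Min can answer every optimality-preserving mixed action on `N` by a value-preserving action
that stays in `N`, then no state of `N` admits an optimal strategy. -/
theorem not_isOptimalFrom_of_stay [Finite S] (G : Game S A B) (hB : ∀ s, (G.actB s).Finite)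
    {top : S} {N : Set S} (htop : top ∉ N) (hpos : ∀ s ∈ N, G.valueLfp top s ≠ 0)
    (hstay : ∀ s ∈ N, ∀ α, G.PreservesOptimality top s α → ∃ b ∈ G.actB s,
      expE (G.pA s α b) (G.valueLfp top) = G.valueLfp top s ∧ (G.pA s α b).support ⊆ N)
    {s : S} (hs : s ∈ N) (σ : Hist S A B → PMF A) : ¬ G.IsOptimalFrom top σ s := by
  intro hopt
  have hex : ∀ h : Hist S A B, ∃ b ∈ G.actB h.2, h.2 ∈ N →
      G.PreservesOptimality top h.2 (σ h) →
      expE (G.pA h.2 (σ h) b) (G.valueLfp top) = G.valueLfp top h.2 ∧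
        (G.pA h.2 (σ h) b).support ⊆ N := by
    intro h
    by_cases hc : h.2 ∈ N ∧ G.PreservesOptimality top h.2 (σ h)
    · obtain ⟨b, hb, hb'⟩ := hstay _ hc.1 _ hc.2
      exact ⟨b, hb, fun _ _ => hb'⟩
    · obtain ⟨b, hb⟩ := G.actB_nonempty h.2
      exact ⟨b, hb, fun h1 h2 => absurd ⟨h1, h2⟩ hc⟩
  choose β hβ hβ' using hex
  have hπ : G.IsMinStrategy fun h => PMF.pure (β h) := fun h => by simpa using hβ h
  have key : ∀ (n : ℕ) (l : List (Step S A B)) (s : S), s ∈ N →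
      G.IsOptimalFrom top (Game.shift σ l) s →
      G.reachN top n (Game.shift σ l) (Game.shift (fun h => PMF.pure (β h)) l) s = 0 := by
    intro n
    induction n with
    | zero =>
      intro l s hs _
      rw [reachN, if_neg (ne_of_mem_of_not_mem hs htop)]
    | succ n ih =>
      intro l s hs hopt
      have hst := ne_of_mem_of_not_mem hs htop
      have hpres := hopt.preservesOptimality hB hst
      have heval : Game.shift σ l ([], s) = σ (l, s) := by simp [Game.shift]
      rw [reachN_succ_of_pure G hst n _ _ (b := β (l, s)) (by simp [Game.shift])]
      rw [heval] at hpres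
      obtain ⟨hval, hsupp⟩ := hβ' (l, s) hs hpres
      refine ENNReal.tsum_eq_zero.2 fun a => ?_
      by_cases ha : (Game.shift σ l ([], s)) a = 0
      · rw [ha, zero_mul]
      rw [expE_congr_of_support _ (g := fun _ => 0), expE_const, mul_zero]
      intro t ht
      have ha' := (PMF.mem_support_iff _ _).2 ha
      have h1 := hopt.shift hB hst (hβ (l, s)) (by rw [heval]; exact hval) ha' ht
      rw [shift_shift] at h1 ⊢
      rw [shift_shift]
      rw [heval] at ha'
      exact ih _ t (hsupp ((PMF.mem_support_bind_iff _ _ _).2 ⟨a, ha', ht⟩)) h1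
  have h0 : G.reach top σ (fun h => PMF.pure (β h)) s = 0 := by
    have := fun n => key n [] s hs hopt
    simp only [shift_nil] at this
    simp [reach, this]
  exact hpos s hs (nonpos_iff_eq_zero.1 ((hopt.2 _ hπ).trans_eq h0))

/-- Max can choose optimality-preserving mixed actions that leave no value-preserving trap of
positive value inside the set of states with optimal strategies. -/
theorem exists_progressing [Finite S] (G : Game S A B) (hB : ∀ s, (G.actB s).Finite) (top : S) :
    ∃ α : S → PMF A,
      (∀ s ∈ G.optimalStates top, s ≠ top → G.valueLfp top s ≠ 0 →
        G.PreservesOptimality top s (α s)) ∧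
      ∀ M ⊆ G.optimalStates top, M.Nonempty → top ∉ M → (∀ s ∈ M, G.valueLfp top s ≠ 0) →
        ∃ s ∈ M, ∀ b ∈ G.actB s,
          expE (G.pA s (α s) b) (G.valueLfp top) = G.valueLfp top s →
          ¬ (G.pA s (α s) b).support ⊆ M := by
  let N : Set S := {s ∈ G.optimalStates top | s ≠ top ∧ G.valueLfp top s ≠ 0}
  let good : Set S → Prop := fun X => ∃ α : S → PMF A,
    (∀ s ∈ X, G.PreservesOptimality top s (α s)) ∧
    ∀ M ⊆ N, (M ∩ X).Nonempty → ∃ s ∈ M ∩ X, ∀ b ∈ G.actB s,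
      expE (G.pA s (α s) b) (G.valueLfp top) = G.valueLfp top s →
      ¬ (G.pA s (α s) b).support ⊆ M
  have hempty : good ∅ := by
    choose α hα using G.exists_support_subset
    refine ⟨α, by simp, fun M _ h => by simp at h⟩
  obtain ⟨X, hX, hmax⟩ := exists_maximal_of_wellFoundedGT good ⟨∅, hempty⟩
  obtain ⟨α, hα, hprog⟩ := hX
  have hNX : N ⊆ X := by
    intro s₀ hs₀
    by_contra hs₀X
    obtain ⟨σ, hσ⟩ := hs₀.1
    refine G.not_isOptimalFrom_of_stay hB (N := N \ X) (fun h => h.1.2.1 rfl)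
      (fun s hs => hs.1.2.2) ?_ ⟨hs₀, hs₀X⟩ σ hσ
    intro s hs γ hγ
    by_contra hcon
    push Not at hcon
    have hext : good (insert s X) := by
      refine ⟨Function.update α s γ, ?_, ?_⟩
      · rintro t (rfl | ht)
        · simpa using hγ
        · rw [Function.update_of_ne (ne_of_mem_of_not_mem ht hs.2)]
          exact hα t ht
      · intro M hM hMX
        by_cases hMX' : (M ∩ X).Nonempty
        · obtain ⟨t, ht, htb⟩ := hprog M hM hMX'
          refine ⟨t, ⟨ht.1, Or.inr ht.2⟩, ?_⟩
          rwa [Function.update_of_ne (ne_of_mem_of_not_mem ht.2 hs.2)]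
        · obtain ⟨t, htM, rfl | htX⟩ := hMX
          · refine ⟨t, ⟨htM, Or.inl rfl⟩, fun b hb hval hsub => ?_⟩
            rw [Function.update_self] at hval hsub
            exact hcon b hb hval fun t' ht' =>
              ⟨hM (hsub ht'), fun h => hMX' ⟨t', hsub ht', h⟩⟩
          · exact absurd ⟨t, htM, htX⟩ hMX'
    exact hs.2 (hmax hext (Set.subset_insert s X) (Set.mem_insert s X))
  refine ⟨α, fun s hs h1 h2 => hα s (hNX ⟨hs, h1, h2⟩), fun M hM hne htop hpos => ?_⟩
  have hMN : M ⊆ N := fun s hs => ⟨hM hs, ne_of_mem_of_not_mem hs htop, hpos s hs⟩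
  obtain ⟨t, ht⟩ := hne
  obtain ⟨s, hs, h⟩ := hprog M hMN ⟨t, ht, hNX (hMN ht)⟩
  exact ⟨s, hs.1, h⟩

/-- A single choice of mixed actions is optimal from every state with an optimal strategy. -/
theorem exists_memoryless_optimal [Finite S] (G : Game S A B) (hB : ∀ s, (G.actB s).Finite)
    (top : S) :
    ∃ α : S → PMF A, (∀ s, (α s).support ⊆ G.actA s) ∧
      ∀ s ∈ G.optimalStates top, ∀ π, G.IsMinStrategy π →
        G.valueLfp top s ≤ G.reach top (memoryless α) π s := by
  set O := G.optimalStates top with hO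
  set v := G.valueLfp top with hv
  obtain ⟨γ, hγ, hγtrap⟩ := G.exists_progressing hB top
  obtain ⟨u, humono, hule, huO, husup, hult⟩ :=
    G.exists_discounted hB top (G.top_mem_optimalStates top)
  obtain ⟨n, hn⟩ : ∃ n, ∀ s, ∀ b ∈ G.actB s, v s < expE (G.pA s (γ s) b) v →
      v s < expE (G.pA s (γ s) b) (u n) := by
    have h1 : ∀ s b, ∃ n, v s < expE (G.pA s (γ s) b) v →
        v s < expE (G.pA s (γ s) b) (u n) := by
      intro s b
      by_cases h : v s < expE (G.pA s (γ s) b) v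
      · have hvu : v = fun t => ⨆ n, u n t := funext fun t => (husup t).symm
        rw [hvu, expE_iSup _ humono, ← hvu, lt_iSup_iff] at h
        exact h.imp fun n hn _ => hn
      · exact ⟨0, fun h' => absurd h' h⟩
    choose k hk using h1
    have hfin : (⋃ s, (k s) '' G.actB s).Finite := Set.finite_iUnion fun s => (hB s).image _
    obtain ⟨m, hm⟩ := hfin.bddAbove
    refine ⟨m, fun s b hb h => (hk s b h).trans_le (expE_mono _ ?_)⟩
    exact humono (hm (Set.mem_iUnion.2 ⟨s, b, hb, rfl⟩))
  have hα : ∀ s, ∃ α : PMF A, α.support ⊆ G.actA s ∧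
      (s ∈ O → s ≠ top → v s ≠ 0 → α = γ s) ∧
      (s ∉ O → u n s = 0 ∨ ∀ b ∈ G.actB s, u n s < expE (G.pA s α b) (u n)) := by
    intro s
    by_cases hsO : s ∈ O
    · by_cases hs : s ≠ top ∧ v s ≠ 0
      · exact ⟨γ s, (hγ s hsO hs.1 hs.2).1, fun _ _ _ => rfl, fun h => absurd hsO h⟩
      · obtain ⟨α, hα⟩ := G.exists_support_subset s
        exact ⟨α, hα, fun _ h1 h2 => absurd ⟨h1, h2⟩ hs, fun h => absurd hsO h⟩
    · obtain ⟨α, hα, h⟩ := G.exists_lt_expE_of_eq_zero_or (hult n s hsO)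
      exact ⟨α, hα, fun h => absurd h hsO, fun _ => h⟩
  choose α hα hαO hαn using hα
  refine ⟨α, hα, fun s hs π hπ => ?_⟩
  refine (huO n s hs).ge.trans ?_
  refine G.le_reach_memoryless hB top α
    (fun s => (hule n s).trans (G.valueLfp_le_one top s)) (fun t ht b hb => ?_) ?_ hπ s
  · by_cases htO : t ∈ O
    · rw [huO n t htO]
      by_cases ht0 : v t = 0
      · rw [← hv, ht0]; exact zero_le
      rw [hαO t htO ht ht0]
      obtain ⟨h1, h2⟩ := (hγ t htO ht ht0).2 b hb
      rcases h1.lt_or_eq with h | h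
      · exact (hn t b hb h).le
      · rw [h]
        exact (expE_congr_of_support _ fun t' ht' => (huO n t' (h2 h.symm ht')).symm).le
    · rcases hαn t htO with h | h
      · rw [h]; exact zero_le
      · exact (h b hb).le
  · intro M hM htop c hc hconst hTrap
    have hMO : M ⊆ O := by
      intro t ht
      by_contra htO
      obtain ⟨b, hb, hsub⟩ := hTrap t ht
      rcases hαn t htO with h | h
      · exact hc ((hconst t ht).symm.trans h)
      · have := h b hb
        rw [expE_eq_of_support_subset hconst hsub, hconst t ht] at this
        exact this.false
    have hvc : ∀ t ∈ M, v t = c := fun t ht => (huO n t (hMO ht)).symm.trans (hconst t ht)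
    have hv0 : ∀ t ∈ M, v t ≠ 0 := fun t ht => by rw [hvc t ht]; exact hc
    obtain ⟨t, ht, hesc⟩ := hγtrap M hMO hM htop hv0
    obtain ⟨b, hb, hsub⟩ := hTrap t ht
    rw [hαO t (hMO ht) (ne_of_mem_of_not_mem ht htop) (hv0 t ht)] at hsub
    refine hesc b hb ?_ hsub
    rw [expE_eq_of_support_subset hvc hsub, ← hv, hvc t ht]

end Game

/-- in a finite-state game with finite Min action sets (and
countable Max action sets), Max has a single memoryless strategy that is
optimal for Reach(⊤) from every state from which Max has any optimal strategy. -/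
theorem stmt14 {S A B : Type} [Finite S] [Countable A] [Countable B]
    (G : Game S A B) (top : S) (htop : G.IsSink top)
    (hB : ∀ s, (G.actB s).Finite)
    (P : (Hist S A B → PMF A) → (Hist S A B → PMF B) → S →
      MeasureTheory.Measure (Play S A B))
    (hP : ∀ σ π s, G.IsMaxStrategy σ → G.IsMinStrategy π →
      G.IsPlayMeasure σ π s (P σ π s)) :
    ∃ σ, G.IsMaxStrategy σ ∧ Memoryless σ ∧
      ∀ s : S,
        (∃ σ', G.IsMaxStrategy σ' ∧ ∀ π, G.IsMinStrategy π →
          G.val P (Reaches top) s ≤ P σ' π s (Reaches top)) →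
        ∀ π, G.IsMinStrategy π →
          G.val P (Reaches top) s ≤ P σ π s (Reaches top) := by
  have hV := G.val_eq_valueLfp top hB hP
  obtain ⟨α, hα, hopt⟩ := G.exists_memoryless_optimal hB top
  have hσ : G.IsMaxStrategy (Game.memoryless α) := fun h => hα h.2
  refine ⟨Game.memoryless α, hσ, fun h h' hh => congrArg α hh, ?_⟩
  rintro s ⟨σ', hσ', hle⟩ π hπ
  rw [hV, (hP _ π s hσ hπ).measure_reaches]
  refine hopt s ⟨σ', hσ', fun π' hπ' => ?_⟩ π hπ
  have := hle π' hπ'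
  rwa [hV, (hP _ π' s hσ' hπ').measure_reaches] at this
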